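/- Let G be a Young function satisfying the Δ₂-condition, Ω ⊂ ℝ^N bounded, and A ⊂ Ω a set with Cap_G(A) = 0, where Cap_G(A) = inf{ ∫_{ℝ^N} G(|φ|) + G(|∇φ|) dx : φ ∈ W^{1,G}(ℝ^N) ∩ C^∞(ℝ^N), φ ≥ 1 on A }. Then for every u ∈ C^∞(clos Ω) and every ε > 0 there exists u_ε ∈ W^{1,G}(Ω) vanishing on a neighborhood of A with ‖u − u_ε‖_{W^{1,G}(Ω)} ≤ ε; consequently W^{1,G}_A(Ω) = W^{1,G}(Ω), where W^{1,G}_A(Ω) is the W^{1,G}-closure of C₀^∞(clos Ω \ A). -/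

import Mathlib

open Filter Topology Set MeasureTheory ENNReal

noncomputable section

variable {N : ℕ}

/-- Luxemburg norm of `v` for a Young function `G` over the measure `μ`. -/
def luxemburgNorm {E : Type*} [MeasurableSpace E] (μ : Measure E)
    (G : ℝ → ℝ) (v : E → ℝ) : ℝ :=
  sInf {l : ℝ | 0 < l ∧ ∫ x, G (|v x| / l) ∂μ ≤ 1}

/-- The `W^{1,G}(Ω)` norm `‖u‖_{L^G(Ω)} + ‖∇u‖_{L^G(Ω)}`. -/
def WnormG (Ω : Set (EuclideanSpace ℝ (Fin N))) (G : ℝ → ℝ)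
    (u : EuclideanSpace ℝ (Fin N) → ℝ) : ℝ :=
  luxemburgNorm (volume.restrict Ω) G u +
    luxemburgNorm (volume.restrict Ω) G (fun x => ‖fderiv ℝ u x‖)

/-- The `G`-capacity of a set `A ⊆ ℝ^N`:
`Cap_G(A) = inf { ∫ G(|φ|) + G(|∇φ|) : φ ∈ W^{1,G}(ℝ^N) ∩ C^∞, φ ≥ 1 on A }`. -/
def capG (G : ℝ → ℝ) (A : Set (EuclideanSpace ℝ (Fin N))) : ℝ :=
  sInf {c : ℝ | ∃ φ : EuclideanSpace ℝ (Fin N) → ℝ, ContDiff ℝ (⊤ : ℕ∞) φ ∧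
    Integrable (fun x => G |φ x| + G ‖fderiv ℝ φ x‖) volume ∧
    (∀ x ∈ A, 1 ≤ φ x) ∧ c = ∫ x, (G |φ x| + G ‖fderiv ℝ φ x‖)}

section Smoothing

variable {E : Type*} [NormedAddCommGroup E] [InnerProductSpace ℝ E] [FiniteDimensional ℝ E]

open scoped NNReal Convolution

/-- Mollification of a Lipschitz function at scale `r`: the Lipschitz constant is kept, and the
value is unchanged wherever the function is constant on the ball of radius `r`. -/
theorem LipschitzWith.exists_contDiff_approx {f : E → ℝ} {L : ℝ≥0} (hf : LipschitzWith L f)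
    {r : ℝ} (hr : 0 < r) :
    ∃ g : E → ℝ, ContDiff ℝ (⊤ : ℕ∞) g ∧ LipschitzWith L g ∧
      (∀ x, |g x - f x| ≤ L * r) ∧
      ∀ x, (∀ y ∈ Metric.ball x r, f y = f x) → g x = f x := by
  borelize E
  let μ : Measure E := Measure.addHaar
  let φ : ContDiffBump (0 : E) := ⟨r / 2, r, by positivity, by linarith⟩
  have hφ : ContDiff ℝ (⊤ : ℕ∞) (φ.normed μ) := φ.contDiff_normed
  have hcs : HasCompactSupport (φ.normed μ) := φ.hasCompactSupport_normed
  have hconv : ConvolutionExists (φ.normed μ) f (ContinuousLinearMap.lsmul ℝ ℝ) μ :=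
    hcs.convolutionExists_left _ hφ.continuous hf.continuous.locallyIntegrable
  refine ⟨(φ.normed μ) ⋆[ContinuousLinearMap.lsmul ℝ ℝ, μ] f,
    hcs.contDiff_convolution_left _ hφ hf.continuous.locallyIntegrable, ?_, ?_, ?_⟩
  · refine LipschitzWith.of_dist_le_mul fun x y => ?_
    have hx := hconv x
    have hy := hconv y
    simp only [ConvolutionExistsAt, ContinuousLinearMap.lsmul_apply, smul_eq_mul] at hx hy
    rw [Real.dist_eq, convolution_def, convolution_def]
    simp only [ContinuousLinearMap.lsmul_apply, smul_eq_mul]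
    rw [← integral_sub hx hy, ← Real.norm_eq_abs]
    calc ‖∫ t, (φ.normed μ t * f (x - t) - φ.normed μ t * f (y - t)) ∂μ‖
        ≤ ∫ t, φ.normed μ t * (L * dist x y) ∂μ := by
          refine norm_integral_le_of_norm_le (φ.integrable_normed.mul_const _)
            (Eventually.of_forall fun t => ?_)
          rw [← mul_sub, norm_mul, Real.norm_of_nonneg (φ.nonneg_normed t)]
          refine mul_le_mul_of_nonneg_left ?_ (φ.nonneg_normed t)
          simpa [Real.dist_eq] using hf.dist_le_mul (x - t) (y - t)
      _ = L * dist x y := by rw [integral_mul_const, φ.integral_normed, one_mul]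
  · intro x
    refine φ.dist_normed_convolution_le hf.continuous.aestronglyMeasurable fun y hy => ?_
    exact (hf.dist_le_mul y x).trans
      (mul_le_mul_of_nonneg_left (Metric.mem_ball.1 hy).le L.coe_nonneg)
  · intro x hx
    exact φ.normed_convolution_eq_right hx

/-- Smooth cutoffs around a set, with gradient controlled by the inverse of the width. -/
theorem exists_contDiff_cutoff_infDist (S : Set E) {δ : ℝ} (hδ : 0 < δ) :
    ∃ η : E → ℝ, ContDiff ℝ (⊤ : ℕ∞) η ∧ (∀ x, |η x| ≤ 2) ∧ (∀ x, ‖fderiv ℝ η x‖ ≤ 6 / δ) ∧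
      (∀ x, Metric.infDist x S < δ / 3 → η x = 1) ∧
      ∀ x, δ ≤ Metric.infDist x S → η =ᶠ[𝓝 x] 0 := by
  have hL : LipschitzWith (Real.toNNReal (6 / δ))
      (fun x => max 0 (min 1 (4 - 6 / δ * Metric.infDist x S))) := by
    refine (LipschitzWith.const_min ?_ 1).const_max 0
    refine LipschitzWith.of_dist_le_mul fun x y => ?_
    rw [Real.coe_toNNReal _ (by positivity), Real.dist_eq]
    have h := (Metric.lipschitz_infDist_pt S).dist_le_mul y x
    rw [Real.dist_eq, NNReal.coe_one, one_mul, dist_comm] at h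
    have : 4 - 6 / δ * Metric.infDist x S - (4 - 6 / δ * Metric.infDist y S)
      = 6 / δ * (Metric.infDist y S - Metric.infDist x S) := by ring
    rw [this, abs_mul, abs_of_pos (by positivity : 0 < 6 / δ)]
    gcongr
  obtain ⟨η, hη, hηL, hηd, hηc⟩ := hL.exists_contDiff_approx (r := δ / 6) (by positivity)
  rw [Real.coe_toNNReal _ (by positivity)] at hηd
  have hone : ∀ x, Metric.infDist x S ≤ δ / 2 →
      max 0 (min 1 (4 - 6 / δ * Metric.infDist x S)) = 1 := by
    intro x hx
    have : 6 / δ * Metric.infDist x S ≤ 6 / δ * (δ / 2) := by gcongr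
    have h2 : 6 / δ * (δ / 2) = 3 := by field_simp; norm_num
    rw [min_eq_left (by linarith), max_eq_right zero_le_one]
  have hzero : ∀ x, 2 / 3 * δ ≤ Metric.infDist x S →
      max 0 (min 1 (4 - 6 / δ * Metric.infDist x S)) = 0 := by
    intro x hx
    have : 6 / δ * (2 / 3 * δ) ≤ 6 / δ * Metric.infDist x S := by gcongr
    have h2 : 6 / δ * (2 / 3 * δ) = 4 := by field_simp; norm_num
    exact max_eq_left ((min_le_right _ _).trans (by linarith))
  have hdist : ∀ x, ∀ y ∈ Metric.ball x (δ / 6),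
      |Metric.infDist y S - Metric.infDist x S| < δ / 6 := by
    intro x y hy
    have h := (Metric.lipschitz_infDist_pt S).dist_le_mul y x
    rw [Real.dist_eq, NNReal.coe_one, one_mul] at h
    exact h.trans_lt hy
  refine ⟨η, hη, fun x => ?_, fun x => ?_, fun x hx => ?_, fun x hx => ?_⟩
  · have h1 := hηd x
    have h2 : 6 / δ * (δ / 6) = 1 := by field_simp
    have h3 : |max 0 (min 1 (4 - 6 / δ * Metric.infDist x S))| ≤ 1 := by
      rw [abs_of_nonneg (le_max_left _ _)]
      exact max_le zero_le_one (min_le_left _ _)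
    have := abs_sub_abs_le_abs_sub (η x) (max 0 (min 1 (4 - 6 / δ * Metric.infDist x S)))
    linarith
  · exact (norm_fderiv_le_of_lipschitz ℝ hηL).trans_eq (Real.coe_toNNReal _ (by positivity))
  · rw [hηc x, hone x (by linarith)]
    intro y hy
    have := abs_lt.1 (hdist x y hy)
    rw [hone x (by linarith), hone y (by linarith)]
  · have hopen : IsOpen {y | 5 / 6 * δ < Metric.infDist y S} :=
      isOpen_lt continuous_const (Metric.continuous_infDist_pt S)
    filter_upwards [hopen.mem_nhds (show 5 / 6 * δ < Metric.infDist x S by linarith)] with y hy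
    replace hy : 5 / 6 * δ < Metric.infDist y S := hy
    rw [hηc y, hzero y (by linarith), Pi.zero_apply]
    intro z hz
    have := abs_lt.1 (hdist y z hz)
    rw [hzero y (by linarith), hzero z (by linarith)]

/-- A smooth function on the line which is `1` above `1/2`, vanishes at `0`, and is Lipschitz. -/
theorem exists_contDiff_step : ∃ (θ : ℝ → ℝ) (L : ℝ≥0), ContDiff ℝ (⊤ : ℕ∞) θ ∧
    LipschitzWith L θ ∧ θ 0 = 0 ∧ ∀ t, 1 / 2 < t → θ t = 1 := by
  have hL : LipschitzWith 8 (fun t : ℝ => max 0 (min 1 (8 * t - 2))) := by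
    refine (LipschitzWith.const_min ?_ 1).const_max 0
    refine LipschitzWith.of_dist_le_mul fun x y => ?_
    rw [Real.dist_eq, Real.dist_eq, show 8 * x - 2 - (8 * y - 2) = 8 * (x - y) by ring, abs_mul]
    simp
  have hone : ∀ t : ℝ, 3 / 8 ≤ t → max 0 (min 1 (8 * t - 2)) = 1 := fun t ht => by
    rw [min_eq_left (by linarith), max_eq_right zero_le_one]
  have hzero : ∀ t : ℝ, t ≤ 1 / 4 → max 0 (min 1 (8 * t - 2)) = 0 := fun t ht =>
    max_eq_left ((min_le_right _ _).trans (by linarith))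
  obtain ⟨θ, hθ, hθL, -, hθc⟩ := hL.exists_contDiff_approx (r := 1 / 8) (by norm_num)
  refine ⟨θ, 8, hθ, hθL, ?_, fun t ht => ?_⟩
  · rw [hθc, hzero 0 (by norm_num)]
    intro y hy
    rw [Metric.mem_ball, Real.dist_eq, abs_lt] at hy
    rw [hzero 0 (by norm_num), hzero y (by linarith [hy.2])]
  · rw [hθc, hone _ (by linarith)]
    intro y hy
    rw [Metric.mem_ball, Real.dist_eq, abs_lt] at hy
    rw [hone _ (by linarith), hone _ (by linarith)]

end Smoothing

/-- The pointwise size `|w| + |∇w|` of the first-order jet of `w`. -/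
def jetNorm {E : Type*} [NormedAddCommGroup E] [NormedSpace ℝ E] (w : E → ℝ) (x : E) : ℝ :=
  |w x| + ‖fderiv ℝ w x‖

section JetNorm

variable {E : Type*} [NormedAddCommGroup E] [NormedSpace ℝ E] {v w χ : E → ℝ} {x : E}

theorem jetNorm_nonneg : 0 ≤ jetNorm w x := add_nonneg (abs_nonneg _) (norm_nonneg _)

theorem jetNorm_eq_zero (h : w =ᶠ[𝓝 x] 0) : jetNorm w x = 0 := by
  have hd : fderiv ℝ w x = 0 := by
    rw [h.fderiv_eq]
    exact fderiv_const_apply (0 : ℝ)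
  rw [jetNorm, h.eq_of_nhds, hd]
  simp

theorem jetNorm_add_le (hv : DifferentiableAt ℝ v x) (hw : DifferentiableAt ℝ w x) :
    jetNorm (fun y => v y + w y) x ≤ jetNorm v x + jetNorm w x := by
  rw [jetNorm, jetNorm, jetNorm, fderiv_fun_add hv hw]
  linarith [abs_add_le (v x) (w x), norm_add_le (fderiv ℝ v x) (fderiv ℝ w x)]

theorem jetNorm_mul_le' (hχ : DifferentiableAt ℝ χ x) (hw : DifferentiableAt ℝ w x) :
    jetNorm (fun y => χ y * w y) x ≤ |χ x| * jetNorm w x + ‖fderiv ℝ χ x‖ * |w x| := by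
  rw [jetNorm, jetNorm, fderiv_fun_mul hχ hw, abs_mul]
  have h := norm_add_le (χ x • fderiv ℝ w x) (w x • fderiv ℝ χ x)
  rw [norm_smul, norm_smul, Real.norm_eq_abs, Real.norm_eq_abs] at h
  linarith

theorem jetNorm_mul_le (hχ : DifferentiableAt ℝ χ x) (hw : DifferentiableAt ℝ w x) :
    jetNorm (fun y => χ y * w y) x ≤ jetNorm χ x * jetNorm w x := by
  refine (jetNorm_mul_le' hχ hw).trans ?_
  have : 0 ≤ ‖fderiv ℝ χ x‖ * ‖fderiv ℝ w x‖ := by positivity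
  unfold jetNorm
  linarith

theorem ContDiff.exists_jetNorm_le [ProperSpace E] (hχ : ContDiff ℝ (⊤ : ℕ∞) χ) {Ω : Set E}
    (hΩ : Bornology.IsBounded Ω) : ∃ K : ℝ, 0 ≤ K ∧ ∀ x ∈ Ω, jetNorm χ x ≤ K := by
  have hc : Continuous (jetNorm χ) :=
    hχ.continuous.abs.add (hχ.continuous_fderiv (by simp)).norm
  obtain ⟨K, hK⟩ := hΩ.isCompact_closure.bddAbove_image hc.continuousOn
  refine ⟨max K 0, le_max_right _ _, fun x hx => ?_⟩
  exact (hK (mem_image_of_mem _ (subset_closure hx))).trans (le_max_left _ _)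

end JetNorm

/-- A monotone gauge on the half-line satisfying a doubling condition. -/
structure IsDoublingGauge (g : ℝ → ℝ≥0∞) : Prop where
  mono : Monotone g
  zero : g 0 = 0
  ne_top : ∀ t, g t ≠ ⊤
  scale : ∀ K : ℝ, ∃ C : ℝ≥0∞, C ≠ ⊤ ∧ ∀ t, 0 ≤ t → g (K * t) ≤ C * g t

section Gauge

variable {g : ℝ → ℝ≥0∞}

theorem IsDoublingGauge.exists_add_le (hg : IsDoublingGauge g) :
    ∃ C : ℝ≥0∞, C ≠ ⊤ ∧ ∀ a b, 0 ≤ a → 0 ≤ b → g (a + b) ≤ C * (g a + g b) := by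
  obtain ⟨C, hC, h⟩ := hg.scale 2
  refine ⟨C, hC, fun a b ha hb => ?_⟩
  rcases le_total a b with hab | hab
  · exact (hg.mono (by linarith)).trans ((h b hb).trans (by gcongr; exact le_add_self))
  · exact (hg.mono (by linarith)).trans ((h a ha).trans (by gcongr; exact le_self_add))

variable {E : Type*} [NormedAddCommGroup E] [NormedSpace ℝ E]
  [MeasurableSpace E] [BorelSpace E] {μ : Measure E} {v w χ : E → ℝ} {S T : Set E}

theorem aemeasurable_gauge_jetNorm (hg : Monotone g) (hw : ContinuousOn w S)
    (hS : MeasurableSet S) : AEMeasurable (fun x => g (jetNorm w x)) (μ.restrict S) :=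
  hg.measurable.comp_aemeasurable
    ((hw.aemeasurable hS).norm.add (measurable_fderiv ℝ w).norm.aemeasurable)

/-- Subadditivity of the first-order modular, up to a constant. -/
theorem IsDoublingGauge.exists_lintegral_add_le (hg : IsDoublingGauge g) (μ : Measure E) :
    ∃ C : ℝ≥0∞, C ≠ ⊤ ∧ ∀ (v w : E → ℝ) (S : Set E), MeasurableSet S →
      (∀ x ∈ S, DifferentiableAt ℝ v x) → (∀ x ∈ S, DifferentiableAt ℝ w x) →
      ∫⁻ x in S, g (jetNorm (fun y => v y + w y) x) ∂μ ≤
        C * (∫⁻ x in S, g (jetNorm v x) ∂μ + ∫⁻ x in S, g (jetNorm w x) ∂μ) := by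
  obtain ⟨C, hC, h⟩ := hg.exists_add_le
  refine ⟨C, hC, fun v w S hS hv hw => ?_⟩
  rw [← lintegral_add_left' (aemeasurable_gauge_jetNorm hg.mono
    (fun x hx => (hv x hx).continuousAt.continuousWithinAt) hS), ← lintegral_const_mul' _ _ hC]
  exact setLIntegral_mono' hS fun x hx => (hg.mono (jetNorm_add_le (hv x hx) (hw x hx))).trans
    (h _ _ jetNorm_nonneg jetNorm_nonneg)

omit [BorelSpace E] in
/-- Multiplication by a cutoff which vanishes near every point of `S \ T`. -/
theorem IsDoublingGauge.exists_lintegral_mul_le [ProperSpace E] (hg : IsDoublingGauge g)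
    (μ : Measure E) (hχ : ContDiff ℝ (⊤ : ℕ∞) χ) {Ω : Set E} (hΩ : Bornology.IsBounded Ω) :
    ∃ C : ℝ≥0∞, C ≠ ⊤ ∧ ∀ (w : E → ℝ) (S T : Set E), S ⊆ Ω → MeasurableSet S →
      MeasurableSet T → (∀ x ∈ S, DifferentiableAt ℝ w x) → (∀ x ∈ S \ T, χ =ᶠ[𝓝 x] 0) →
      ∫⁻ x in S, g (jetNorm (fun y => χ y * w y) x) ∂μ ≤
        C * ∫⁻ x in T ∩ S, g (jetNorm w x) ∂μ := by
  obtain ⟨K, hK, hχK⟩ := hχ.exists_jetNorm_le hΩ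
  obtain ⟨C, hC, h⟩ := hg.scale K
  refine ⟨C, hC, fun w S T hSΩ hS hT hw hz => ?_⟩
  rw [← Measure.restrict_restrict hT, ← lintegral_indicator hT, ← lintegral_const_mul' _ _ hC]
  refine setLIntegral_mono' hS fun x hx => ?_
  by_cases hxT : x ∈ T
  · rw [indicator_of_mem hxT]
    refine (hg.mono ?_).trans (h _ jetNorm_nonneg)
    exact (jetNorm_mul_le (hχ.differentiable (by simp) x) (hw x hx)).trans
      (mul_le_mul_of_nonneg_right (hχK x (hSΩ hx)) jetNorm_nonneg)
  · rw [indicator_of_notMem hxT, mul_zero, jetNorm_eq_zero, hg.zero]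
    filter_upwards [hz x ⟨hx, hxT⟩] with y hy
    simp [hy]

end Gauge

/-- Approximability of `u` on `U ∩ Ω` by globally smooth functions, in the first-order modular
of the gauge `g`. -/
def IsSmoothlyApproximable {E : Type*} [NormedAddCommGroup E] [NormedSpace ℝ E]
    [MeasurableSpace E] (μ : Measure E) (g : ℝ → ℝ≥0∞) (Ω : Set E) (u : E → ℝ) (U : Set E) :
    Prop :=
  ∀ ε : ℝ≥0∞, ε ≠ 0 → ∃ f : E → ℝ, ContDiff ℝ (⊤ : ℕ∞) f ∧
    ∫⁻ x in U ∩ Ω, g (jetNorm (fun y => u y - f y) x) ∂μ ≤ ε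

theorem ENNReal.exists_mul_le {C ε : ℝ≥0∞} (hC : C ≠ ⊤) (hε : ε ≠ 0) :
    ∃ ρ : ℝ≥0∞, ρ ≠ 0 ∧ C * ρ ≤ ε := by
  rcases eq_or_ne ε ⊤ with rfl | hε'
  · exact ⟨1, one_ne_zero, le_top⟩
  · exact ⟨ε / C, (ENNReal.div_pos hε hC).ne', ENNReal.mul_div_le⟩

theorem IsSmoothlyApproximable.mono {E : Type*} [NormedAddCommGroup E] [NormedSpace ℝ E]
    [MeasurableSpace E] {μ : Measure E} {g : ℝ → ℝ≥0∞} {Ω : Set E} {u : E → ℝ} {U V : Set E}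
    (h : IsSmoothlyApproximable μ g Ω u V) (hUV : U ⊆ V) :
    IsSmoothlyApproximable μ g Ω u U := fun ε hε =>
  let ⟨f, hf, hle⟩ := h ε hε
  ⟨f, hf, (lintegral_mono_set (inter_subset_inter_left _ hUV)).trans hle⟩

section Approximable

variable {E : Type*} [NormedAddCommGroup E] [InnerProductSpace ℝ E] [FiniteDimensional ℝ E]
  [MeasurableSpace E] [BorelSpace E] {μ : Measure E} {g : ℝ → ℝ≥0∞} {Ω : Set E} {u : E → ℝ}

omit [FiniteDimensional ℝ E] [MeasurableSpace E] [BorelSpace E] in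
theorem ContDiffOn.differentiableAt_of_isOpen (hu : ContDiffOn ℝ (⊤ : ℕ∞) u Ω) (hΩ : IsOpen Ω)
    {x : E} (hx : x ∈ Ω) : DifferentiableAt ℝ u x :=
  (hu.contDiffAt (hΩ.mem_nhds hx)).differentiableAt (by simp)

/-- Modular error of a function glued from two approximations by a cutoff `χ`, which equals `1`
near every point of `S \ T`. -/
theorem IsDoublingGauge.exists_lintegral_glue_le (hg : IsDoublingGauge g) (μ : Measure E)
    (hΩ : IsOpen Ω) (hΩb : Bornology.IsBounded Ω) (hu : ContDiffOn ℝ (⊤ : ℕ∞) u Ω) :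
    ∃ C : ℝ≥0∞, C ≠ ⊤ ∧ ∀ χ : E → ℝ, ContDiff ℝ (⊤ : ℕ∞) χ → ∃ D : ℝ≥0∞, D ≠ ⊤ ∧
      ∀ (f₁ f₂ : E → ℝ) (S T : Set E), S ⊆ Ω → MeasurableSet S →
      MeasurableSet T → ContDiff ℝ (⊤ : ℕ∞) f₁ → ContDiff ℝ (⊤ : ℕ∞) f₂ →
      (∀ x ∈ S \ T, χ =ᶠ[𝓝 x] 1) →
      ∫⁻ x in S, g (jetNorm (fun y => u y - (χ y * f₁ y + (1 - χ y) * f₂ y)) x) ∂μ ≤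
        C * (∫⁻ x in S, g (jetNorm (fun y => χ y * (u y - f₁ y)) x) ∂μ +
          D * ∫⁻ x in T ∩ S, g (jetNorm (fun y => u y - f₂ y) x) ∂μ) := by
  obtain ⟨C, hC, hadd⟩ := hg.exists_lintegral_add_le μ
  refine ⟨C, hC, fun χ hχ => ?_⟩
  obtain ⟨D, hD, hmul⟩ := hg.exists_lintegral_mul_le μ (contDiff_const.sub hχ :
    ContDiff ℝ (⊤ : ℕ∞) fun y => 1 - χ y) hΩb
  refine ⟨D, hD, fun f₁ f₂ S T hSΩ hS hT hf₁ hf₂ hone => ?_⟩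
  have hd : ∀ f : E → ℝ, ContDiff ℝ (⊤ : ℕ∞) f →
      ∀ x ∈ S, DifferentiableAt ℝ (fun y => u y - f y) x := fun f hf x hx =>
    (hu.differentiableAt_of_isOpen hΩ (hSΩ hx)).sub (hf.differentiable (by simp) x)
  have hχd : Differentiable ℝ χ := hχ.differentiable (by simp)
  have heq : (fun y => u y - (χ y * f₁ y + (1 - χ y) * f₂ y)) =
      fun y => χ y * (u y - f₁ y) + (1 - χ y) * (u y - f₂ y) := by
    funext y; ring
  rw [heq]
  refine (hadd (fun y => χ y * (u y - f₁ y)) (fun y => (1 - χ y) * (u y - f₂ y)) S hS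
    (fun x hx => (hχd x).mul (hd f₁ hf₁ x hx))
    (fun x hx => ((hχd x).const_sub 1).mul (hd f₂ hf₂ x hx))).trans ?_
  gcongr
  refine hmul (fun y => u y - f₂ y) S T hSΩ hS hT (hd f₂ hf₂) fun x hx => ?_
  filter_upwards [hone x hx] with y hy
  simp [hy]

omit [MeasurableSpace E] [BorelSpace E] in
/-- A smooth cutoff adapted to a compact set in an open set. -/
theorem IsCompact.exists_contDiff_cutoff {K U : Set E} (hK : IsCompact K) (hU : IsOpen U)
    (hKU : K ⊆ U) : ∃ (χ : E → ℝ) (W : Set E), ContDiff ℝ (⊤ : ℕ∞) χ ∧ IsOpen W ∧ K ⊆ W ∧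
      (∀ x ∈ W, χ x = 1) ∧ ∀ x ∉ U, χ =ᶠ[𝓝 x] 0 := by
  rcases K.eq_empty_or_nonempty with rfl | hne
  · exact ⟨0, ∅, contDiff_const, isOpen_empty, le_rfl, by simp, fun x _ => EventuallyEq.rfl⟩
  obtain ⟨δ, hδ, hδU⟩ := hK.exists_thickening_subset_open hU hKU
  obtain ⟨χ, hχ, -, -, hone, hzero⟩ := exists_contDiff_cutoff_infDist K hδ
  refine ⟨χ, {x | Metric.infDist x K < δ / 3}, hχ,
    isOpen_lt (Metric.continuous_infDist_pt K) continuous_const, fun x hx => ?_, hone,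
    fun x hx => hzero x ?_⟩
  · show Metric.infDist x K < δ / 3
    rw [Metric.infDist_zero_of_mem hx]
    positivity
  · by_contra! h
    exact hx (hδU ((Metric.mem_thickening_iff_infDist_lt hne).2 h))

/-- Two approximable regions can be glued near compact subsets. -/
theorem IsSmoothlyApproximable.union (hg : IsDoublingGauge g) (hΩ : IsOpen Ω)
    (hΩb : Bornology.IsBounded Ω) (hu : ContDiffOn ℝ (⊤ : ℕ∞) u Ω) {K U V : Set E}
    (hK : IsCompact K) (hKU : K ⊆ U) (hUo : IsOpen U) (hVo : IsOpen V)
    (hU : IsSmoothlyApproximable μ g Ω u U) (hV : IsSmoothlyApproximable μ g Ω u V) :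
    ∃ W, IsOpen W ∧ K ⊆ W ∧ IsSmoothlyApproximable μ g Ω u (W ∪ V) := by
  obtain ⟨χ, W, hχ, hW, hKW, hone, hzero⟩ := hK.exists_contDiff_cutoff hUo hKU
  refine ⟨W, hW, hKW, fun ε hε => ?_⟩
  obtain ⟨C, hC, hglue⟩ := hg.exists_lintegral_glue_le μ hΩ hΩb hu
  obtain ⟨D, hD, hglue⟩ := hglue χ hχ
  obtain ⟨D', hD', hmul⟩ := hg.exists_lintegral_mul_le μ hχ hΩb
  obtain ⟨ρ, hρ, hρε⟩ := ENNReal.exists_mul_le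
    (ENNReal.mul_ne_top hC (ENNReal.add_ne_top.2 ⟨hD', hD⟩)) hε
  obtain ⟨f₁, hf₁, h₁⟩ := hU ρ hρ
  obtain ⟨f₂, hf₂, h₂⟩ := hV ρ hρ
  have hS : MeasurableSet ((W ∪ V) ∩ Ω) := ((hW.union hVo).inter hΩ).measurableSet
  refine ⟨fun y => χ y * f₁ y + (1 - χ y) * f₂ y,
    (hχ.mul hf₁).add ((contDiff_const.sub hχ).mul hf₂), ?_⟩
  refine (hglue f₁ f₂ _ V inter_subset_right hS hVo.measurableSet hf₁ hf₂ fun x hx => ?_).trans ?_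
  · have hxW : x ∈ W := hx.1.1.resolve_right hx.2
    filter_upwards [hW.mem_nhds hxW] with y hy using hone y hy
  · refine le_trans ?_ hρε
    rw [mul_assoc, add_mul]
    gcongr
    · refine (hmul _ _ U inter_subset_right hS hUo.measurableSet (fun x hx =>
        (hu.differentiableAt_of_isOpen hΩ hx.2).sub (hf₁.differentiable (by simp) x))
        fun x hx => hzero x hx.2).trans ?_
      gcongr
      exact (lintegral_mono_set (inter_subset_inter_right U inter_subset_right)).trans h₁
    · exact (lintegral_mono_set (inter_subset_inter_right V inter_subset_right)).trans h₂

/-- Approximability on a neighborhood of a compact set is a local property. -/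
theorem IsCompact.exists_isSmoothlyApproximable (hg : IsDoublingGauge g) (hΩ : IsOpen Ω)
    (hΩb : Bornology.IsBounded Ω) (hu : ContDiffOn ℝ (⊤ : ℕ∞) u Ω) {K : Set E}
    (hK : IsCompact K)
    (hloc : ∀ x ∈ K, ∃ U, IsOpen U ∧ x ∈ U ∧ IsSmoothlyApproximable μ g Ω u U) :
    ∃ W, IsOpen W ∧ K ⊆ W ∧ IsSmoothlyApproximable μ g Ω u W := by
  suffices h : ∃ L W, IsCompact L ∧ K ⊆ L ∧ IsOpen W ∧ L ⊆ W ∧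
      IsSmoothlyApproximable μ g Ω u W by
    obtain ⟨L, W, -, hKL, hW, hLW, h⟩ := h
    exact ⟨W, hW, hKL.trans hLW, h⟩
  refine hK.induction_on (p := fun S => ∃ L W, IsCompact L ∧ S ⊆ L ∧ IsOpen W ∧ L ⊆ W ∧
    IsSmoothlyApproximable μ g Ω u W) ?_ ?_ ?_ ?_
  · exact ⟨∅, ∅, isCompact_empty, le_rfl, isOpen_empty, le_rfl,
      fun ε _ => ⟨0, contDiff_const, by simp⟩⟩
  · rintro s t hst ⟨L, W, hL, htL, h⟩
    exact ⟨L, W, hL, hst.trans htL, h⟩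
  · rintro s t ⟨L₁, U, hL₁, hs, hU, hLU, hUa⟩ ⟨L₂, V, hL₂, ht, hV, hLV, hVa⟩
    obtain ⟨W, hW, hLW, hWV⟩ := hUa.union hg hΩ hΩb hu hL₁ hLU hU hV hVa
    exact ⟨L₁ ∪ L₂, W ∪ V, hL₁.union hL₂, union_subset_union hs ht, hW.union hV,
      union_subset_union hLW hLV, hWV⟩
  · intro x hx
    obtain ⟨U, hU, hxU, hUa⟩ := hloc x hx
    obtain ⟨r, hr, hrU⟩ := Metric.nhds_basis_closedBall.mem_iff.1 (hU.mem_nhds hxU)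
    exact ⟨Metric.closedBall x r, mem_nhdsWithin_of_mem_nhds (Metric.closedBall_mem_nhds x hr),
      Metric.closedBall x r, U, isCompact_closedBall x r, le_rfl, hU, hrU, hUa⟩

/-- Interior points have approximable neighborhoods. -/
theorem exists_isSmoothlyApproximable_of_mem (hg : IsDoublingGauge g) (hΩ : IsOpen Ω)
    (hu : ContDiffOn ℝ (⊤ : ℕ∞) u Ω) {x : E} (hx : x ∈ Ω) :
    ∃ U, IsOpen U ∧ x ∈ U ∧ IsSmoothlyApproximable μ g Ω u U := by
  obtain ⟨χ, W, hχ, hW, hxW, hone, hzero⟩ :=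
    (isCompact_singleton (x := x)).exists_contDiff_cutoff hΩ (singleton_subset_iff.2 hx)
  refine ⟨W, hW, hxW rfl, fun ε _ => ⟨fun y => χ y * u y, ?_, ?_⟩⟩
  · refine contDiff_iff_contDiffAt.2 fun y => ?_
    by_cases hy : y ∈ Ω
    · exact hχ.contDiffAt.mul (hu.contDiffAt (hΩ.mem_nhds hy))
    · refine (contDiffAt_const (c := (0 : ℝ))).congr_of_eventuallyEq ?_
      filter_upwards [hzero y hy] with z hz
      simp [hz]
  · refine (le_of_eq ?_).trans (zero_le (a := ε))
    rw [setLIntegral_congr_fun (g := fun _ => 0) (hW.inter hΩ).measurableSet fun y hy => ?_,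
      lintegral_zero]
    dsimp only
    rw [jetNorm_eq_zero, hg.zero]
    filter_upwards [hW.mem_nhds hy.1] with z hz
    simp [hone z hz]

omit [FiniteDimensional ℝ E] [MeasurableSpace E] [BorelSpace E] in
/-- Near a point of `closure Ω`, the classical gradient of `u` in `Ω` is bounded. -/
theorem ContDiffOn.exists_fderiv_le (hΩ : IsOpen Ω)
    (hu : ContDiffOn ℝ (⊤ : ℕ∞) u (closure Ω)) {x : E} (hx : x ∈ closure Ω) :
    ∃ M r : ℝ, 0 < r ∧ ∀ y ∈ Metric.ball x r ∩ Ω, ‖fderiv ℝ u y‖ ≤ M := by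
  have h1 : ContDiffWithinAt ℝ (0 + 1) u (closure Ω) x := (hu x hx).of_le (by simp)
  obtain ⟨V, hV, -, u', hu', hc⟩ :=
    (contDiffWithinAt_succ_iff_hasFDerivWithinAt (by simp)).1 h1
  rw [insert_eq_of_mem hx] at hV
  have hb : ∀ᶠ y in 𝓝[V] x, ‖u' y‖ < ‖u' x‖ + 1 :=
    hc.continuousWithinAt.norm.eventually (gt_mem_nhds (by linarith))
  have hle : 𝓝[closure Ω] x ≤ 𝓝[V] x := nhdsWithin_le_of_mem hV
  obtain ⟨r, hr, hsub⟩ := Metric.mem_nhdsWithin_iff.1 (inter_mem hV (hle hb))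
  refine ⟨‖u' x‖ + 1, r, hr, fun y hy => ?_⟩
  have hVy : V ∈ 𝓝 y := by
    filter_upwards [Metric.isOpen_ball.mem_nhds hy.1, hΩ.mem_nhds hy.2] with z hz hzΩ
    exact (hsub ⟨hz, subset_closure hzΩ⟩).1
  have hyV := hsub ⟨hy.1, subset_closure hy.2⟩
  rw [((hu' y hyV.1).hasFDerivAt hVy).fderiv]
  exact hyV.2.le

/-- The points of `X` at which `u` is Lipschitz with constant `n` at scale `1 / n`. -/
def pointwiseLipschitzSet {E : Type*} [PseudoMetricSpace E] (u : E → ℝ) (X : Set E) (n : ℕ) :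
    Set E :=
  {x ∈ X | ∀ y ∈ X, n * dist y x < 1 → |u y - u x| ≤ n * dist y x}

theorem isClosed_pointwiseLipschitzSet {E : Type*} [PseudoMetricSpace E] {u : E → ℝ} {X : Set E}
    (hX : IsClosed X) (hu : ContinuousOn u X)
    (n : ℕ) : IsClosed (pointwiseLipschitzSet u X n) := by
  refine isClosed_of_closure_subset fun x hx => ?_
  have hxX : x ∈ X := closure_minimal (fun y hy => hy.1) hX hx
  refine ⟨hxX, fun y hy hxy => ?_⟩
  obtain ⟨s, hs, hsx⟩ := mem_closure_iff_seq_limit.1 hx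
  have hus : Tendsto (fun k => u (s k)) atTop (𝓝 (u x)) :=
    (hu x hxX).tendsto.comp (tendsto_nhdsWithin_iff.2 ⟨hsx, Eventually.of_forall fun k => (hs k).1⟩)
  have hd : Tendsto (fun k => n * dist y (s k)) atTop (𝓝 (n * dist y x)) :=
    (tendsto_const_nhds.dist hsx).const_mul _
  refine le_of_tendsto_of_tendsto (tendsto_const_nhds.sub hus).abs hd ?_
  filter_upwards [hd.eventually (gt_mem_nhds hxy)] with k hk using (hs k).2 y hy hk

omit [FiniteDimensional ℝ E] [MeasurableSpace E] [BorelSpace E] in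
theorem exists_mem_pointwiseLipschitzSet {X : Set E} (hu : DifferentiableOn ℝ u X) {x : E}
    (hx : x ∈ X) : ∃ n, x ∈ pointwiseLipschitzSet u X n := by
  obtain ⟨c, hc⟩ := (hu x hx).isBigO_sub.bound
  obtain ⟨r, hr, hsub⟩ := Metric.mem_nhdsWithin_iff.1 hc
  obtain ⟨n, hn⟩ := exists_nat_gt (max c (1 / r))
  refine ⟨n, hx, fun y hy hyx => ?_⟩
  have hn1 : 1 < n * r := (div_lt_iff₀ hr).1 ((le_max_right _ _).trans_lt hn)
  have hn0 : (0 : ℝ) < n := lt_of_le_of_lt ((by positivity : 0 ≤ 1 / r).trans (le_max_right _ _)) hn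
  have hyr : dist y x < r := lt_of_mul_lt_mul_left (hyx.trans hn1) hn0.le
  have h : ‖u y - u x‖ ≤ c * ‖y - x‖ := hsub ⟨hyr, hy⟩
  rw [← dist_eq_norm y x, Real.norm_eq_abs] at h
  exact h.trans (mul_le_mul_of_nonneg_right ((le_max_left _ _).trans hn.le) dist_nonneg)

/-- If `u` is uniformly Lipschitz at the points of a closed set `B` outside `Ω`, near `x₀`, and
locally approximable off `B`, then `u` is approximable near `x₀`. -/
theorem isSmoothlyApproximable_ball_of_subset_pointwiseLipschitzSet
    [IsFiniteMeasureOnCompacts μ] (hg : IsDoublingGauge g)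
    (hΩ : IsOpen Ω) (hΩb : Bornology.IsBounded Ω) (hu : ContDiffOn ℝ (⊤ : ℕ∞) u (closure Ω))
    {B : Set E} (hB : IsClosed B) (hBΩ : Disjoint B Ω)
    (hloc : ∀ x ∈ closure Ω \ B, ∃ U, IsOpen U ∧ x ∈ U ∧ IsSmoothlyApproximable μ g Ω u U)
    {x₀ : E} (hx₀ : x₀ ∈ B) {r M : ℝ} (hr : 0 < r) {n : ℕ} (hnr : n * r < 1)
    (hBn : B ∩ Metric.ball x₀ r ⊆ pointwiseLipschitzSet u (closure Ω) n)
    (hM : ∀ y ∈ Metric.ball x₀ r ∩ Ω, ‖fderiv ℝ u y‖ ≤ M) :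
    IsSmoothlyApproximable μ g Ω u (Metric.ball x₀ (r / 2)) := by
  intro ε hε
  have huΩ : ContDiffOn ℝ (⊤ : ℕ∞) u Ω := hu.mono subset_closure
  set S : Set E := B ∩ Metric.closedBall x₀ (r / 2)
  have hSc : IsCompact S := (isCompact_closedBall x₀ (r / 2)).inter_left hB
  have hSne : S.Nonempty := ⟨x₀, hx₀, Metric.mem_closedBall_self (by positivity)⟩
  have hSn : S ⊆ pointwiseLipschitzSet u (closure Ω) n := fun x hx =>
    hBn ⟨hx.1, Metric.closedBall_subset_ball (by linarith) hx.2⟩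
  have hn0 : (0 : ℝ) ≤ n := n.cast_nonneg
  obtain ⟨v, hv, huv⟩ : ∃ v : E → ℝ, LipschitzWith n v ∧ EqOn u v S := by
    refine LipschitzOnWith.extend_real (LipschitzOnWith.of_dist_le_mul fun x hx y hy => ?_)
    refine (hSn hy).2 x (hSn hx).1 (lt_of_le_of_lt ?_ hnr)
    gcongr
    have h1 := Metric.mem_closedBall.1 hx.2
    have h2 := Metric.mem_closedBall'.1 hy.2
    linarith [dist_triangle x x₀ y]
  obtain ⟨C, hC, hglue⟩ := hg.exists_lintegral_glue_le μ hΩ hΩb huΩ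
  obtain ⟨ρ, hρ, hρε⟩ := ENNReal.exists_mul_le (C := C * 2)
    (ENNReal.mul_ne_top hC ENNReal.ofNat_ne_top) hε
  set P : ℝ := 2 * (3 * n + (M + n)) + 18 * n
  obtain ⟨δ, ⟨⟨hδm, hδ1⟩, hδr⟩, hδ⟩ : ∃ δ : ℝ, ((g P * μ.restrict Ω (Metric.cthickening δ S) < ρ ∧
      δ < 1) ∧ δ < r / 2) ∧ 0 < δ := by
    have hfin : μ.restrict Ω (Metric.cthickening 1 S) ≠ ⊤ :=
      ((Measure.restrict_apply_le _ _).trans_lt hSc.cthickening.measure_lt_top).ne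
    have hzero : μ.restrict Ω (closure S) = 0 := by
      rw [hSc.isClosed.closure_eq, Measure.restrict_apply hSc.measurableSet,
        (hBΩ.mono_left inter_subset_left).inter_eq, measure_empty]
    have ht := ENNReal.Tendsto.const_mul (a := g P)
      (tendsto_measure_cthickening ⟨1, one_pos, hfin⟩) (Or.inr (hg.ne_top P))
    rw [hzero, mul_zero] at ht
    have h := ((ht.eventually (gt_mem_nhds (pos_iff_ne_zero.2 hρ))).and
      (gt_mem_nhds one_pos)).and (gt_mem_nhds (half_pos hr))
    exact ((h.filter_mono nhdsWithin_le_nhds).and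
      (self_mem_nhdsWithin : Ioi (0 : ℝ) ∈ 𝓝[>] 0)).exists
  obtain ⟨vδ, hvδ, hvδL, hvδv, -⟩ := hv.exists_contDiff_approx hδ
  obtain ⟨η, hη, hη2, hηd, hη1, hη0⟩ := exists_contDiff_cutoff_infDist S hδ
  obtain ⟨D, hD, hglue⟩ := hglue η hη
  obtain ⟨ρ', hρ', hρρ⟩ := ENNReal.exists_mul_le hD hρ
  obtain ⟨W, hW, hKW, hWa⟩ : ∃ W, IsOpen W ∧
      (closure Ω ∩ Metric.closedBall x₀ (r / 2)) ∩ {y | δ / 3 ≤ Metric.infDist y S} ⊆ W ∧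
      IsSmoothlyApproximable μ g Ω u W := by
    refine IsCompact.exists_isSmoothlyApproximable hg hΩ hΩb huΩ
      ((hΩb.isCompact_closure.inter_right Metric.isClosed_closedBall).inter_right
        (isClosed_le continuous_const (Metric.continuous_infDist_pt S))) fun x hx => ?_
    refine hloc x ⟨hx.1.1, fun hxB => ?_⟩
    have h : δ / 3 ≤ Metric.infDist x S := hx.2
    rw [Metric.infDist_zero_of_mem (show x ∈ S from ⟨hxB, hx.1.2⟩)] at h
    linarith
  obtain ⟨f, hf, hfle⟩ := hWa ρ' hρ'
  have hS : MeasurableSet (Metric.ball x₀ (r / 2) ∩ Ω) :=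
    (Metric.isOpen_ball.inter hΩ).measurableSet
  refine ⟨fun y => η y * vδ y + (1 - η y) * f y,
    (hη.mul hvδ).add ((contDiff_const.sub hη).mul hf), ?_⟩
  refine (hglue vδ f _ W inter_subset_right hS hW.measurableSet hvδ hf fun x hx => ?_).trans ?_
  · have hx' : Metric.infDist x S < δ / 3 := by
      by_contra! h
      exact hx.2 (hKW ⟨⟨subset_closure hx.1.2, Metric.ball_subset_closedBall hx.1.1⟩, h⟩)
    filter_upwards [(isOpen_lt (Metric.continuous_infDist_pt S) continuous_const).mem_nhds hx']
      with y hy using hη1 y hy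
  refine le_trans ?_ hρε
  rw [mul_assoc, two_mul]
  gcongr
  · refine le_trans ?_ hδm.le
    calc ∫⁻ x in Metric.ball x₀ (r / 2) ∩ Ω, g (jetNorm (fun y => η y * (u y - vδ y)) x) ∂μ
        ≤ ∫⁻ x in Metric.ball x₀ (r / 2) ∩ Ω,
            (Metric.cthickening δ S).indicator (fun _ => g P) x ∂μ := by
          refine setLIntegral_mono' hS fun x hx => ?_
          have hud : DifferentiableAt ℝ u x := huΩ.differentiableAt_of_isOpen hΩ hx.2
          have hvd : DifferentiableAt ℝ vδ x := hvδ.differentiable (by simp) x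
          rcases le_or_gt (Metric.infDist x S) δ with hxδ | hxδ
          · obtain ⟨b, hb, hxb⟩ := hSc.exists_infDist_eq_dist hSne x
            rw [hxb] at hxδ
            have hmem : x ∈ Metric.cthickening δ S := Metric.mem_cthickening_of_dist_le x b δ S hb hxδ
            rw [indicator_of_mem hmem]
            refine hg.mono ?_
            have h1 : |u x - u b| ≤ n * δ :=
              ((hSn hb).2 x (subset_closure hx.2) (lt_of_le_of_lt
                (mul_le_mul_of_nonneg_left (by linarith) hn0) hnr)).trans (by gcongr)
            have h2 : |v b - v x| ≤ n * δ := by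
              have := hv.dist_le_mul b x
              rw [Real.dist_eq, NNReal.coe_natCast, dist_comm] at this
              exact this.trans (by gcongr)
            have h3 : |vδ x - v x| ≤ n * δ := by simpa using hvδv x
            have hw : |u x - vδ x| ≤ 3 * n * δ := by
              rw [huv hb] at h1
              rw [abs_le] at h1 h2 h3 ⊢
              constructor <;> linarith [h1.1, h1.2, h2.1, h2.2, h3.1, h3.2]
            have hdw : ‖fderiv ℝ (fun y => u y - vδ y) x‖ ≤ M + n := by
              rw [fderiv_fun_sub hud hvd]
              refine (norm_sub_le _ _).trans (add_le_add (hM x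
                ⟨Metric.ball_subset_ball (by linarith) hx.1, hx.2⟩) ?_)
              simpa using norm_fderiv_le_of_lipschitz ℝ hvδL (x₀ := x)
            have hj : jetNorm (fun y => u y - vδ y) x ≤ 3 * n + (M + n) :=
              add_le_add (hw.trans (mul_le_of_le_one_right (by positivity) hδ1.le)) hdw
            refine (jetNorm_mul_le' (hη.differentiable (by simp) x) (hud.sub hvd)).trans ?_
            refine add_le_add (mul_le_mul (hη2 x) hj jetNorm_nonneg zero_le_two) ?_
            refine (mul_le_mul (hηd x) hw (abs_nonneg _) (by positivity)).trans_eq ?_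
            field_simp
            ring
          · have h0 : jetNorm (fun y => η y * (u y - vδ y)) x = 0 := by
              refine jetNorm_eq_zero ?_
              filter_upwards [hη0 x hxδ.le] with y hy
              simp [hy]
            rw [h0, hg.zero]
            exact zero_le
      _ = g P * μ.restrict (Metric.ball x₀ (r / 2) ∩ Ω) (Metric.cthickening δ S) :=
          lintegral_indicator_const Metric.isClosed_cthickening.measurableSet _
      _ ≤ g P * μ.restrict Ω (Metric.cthickening δ S) := by
          gcongr
          exact inter_subset_right
  · refine le_trans ?_ hρρ
    gcongr
    exact (lintegral_mono_set (inter_subset_inter_right W inter_subset_right)).trans hfle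

/-- A function which is smooth on the closure of a bounded open set `Ω` (in the sense of
one-sided Taylor expansions) is a limit, in the first-order modular on `Ω`, of functions smooth on
the whole space. The set of bad points is shown to be empty by the Baire category theorem. -/
theorem ContDiffOn.isSmoothlyApproximable_closure [IsFiniteMeasureOnCompacts μ]
    (hg : IsDoublingGauge g) (hΩ : IsOpen Ω) (hΩb : Bornology.IsBounded Ω)
    (hu : ContDiffOn ℝ (⊤ : ℕ∞) u (closure Ω)) :
    IsSmoothlyApproximable μ g Ω u Ω := by
  have huΩ : ContDiffOn ℝ (⊤ : ℕ∞) u Ω := hu.mono subset_closure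
  suffices hloc : ∀ x ∈ closure Ω, ∃ U, IsOpen U ∧ x ∈ U ∧ IsSmoothlyApproximable μ g Ω u U by
    obtain ⟨W, -, hW, h⟩ := hΩb.isCompact_closure.exists_isSmoothlyApproximable hg hΩ hΩb huΩ hloc
    exact h.mono (subset_closure.trans hW)
  set O : Set E := ⋃₀ {U | IsOpen U ∧ IsSmoothlyApproximable μ g Ω u U}
  have hOo : IsOpen O := isOpen_sUnion fun U hU => hU.1
  set B : Set E := closure Ω \ O
  have hB : IsClosed B := isClosed_closure.sdiff hOo
  have hloc : ∀ x ∈ closure Ω \ B, ∃ U, IsOpen U ∧ x ∈ U ∧ IsSmoothlyApproximable μ g Ω u U := by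
    intro x hx
    have hxO : x ∈ O := by
      by_contra h
      exact hx.2 ⟨hx.1, h⟩
    obtain ⟨U, hU, hxU⟩ := hxO
    exact ⟨U, hU.1, hxU, hU.2⟩
  have hBΩ : Disjoint B Ω := by
    refine disjoint_left.2 fun x hxB hxΩ => hxB.2 ?_
    obtain ⟨U, hU, hxU, h⟩ := exists_isSmoothlyApproximable_of_mem (μ := μ) hg hΩ huΩ hxΩ
    exact ⟨U, ⟨hU, h⟩, hxU⟩
  rcases B.eq_empty_or_nonempty with hemp | hne
  · intro x hx
    exact hloc x ⟨hx, by simp [hemp]⟩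
  exfalso
  have : Nonempty B := hne.to_subtype
  have : CompleteSpace B := hB.isComplete.completeSpace_coe
  obtain ⟨n, x₀, hx₀⟩ := nonempty_interior_of_iUnion_of_closed (X := B)
    (f := fun n => Subtype.val ⁻¹' pointwiseLipschitzSet u (closure Ω) n)
    (fun n => (isClosed_pointwiseLipschitzSet isClosed_closure hu.continuousOn n).preimage
      continuous_subtype_val) (by
      refine eq_univ_of_forall fun x => mem_iUnion.2 ?_
      exact exists_mem_pointwiseLipschitzSet (hu.differentiableOn (by simp)) x.2.1)
  obtain ⟨r₁, hr₁, hsub⟩ := Metric.mem_nhds_iff.1 (mem_interior_iff_mem_nhds.1 hx₀)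
  obtain ⟨M, r₂, hr₂, hM⟩ := hu.exists_fderiv_le hΩ x₀.2.1
  set r := min (min r₁ r₂) (1 / (n + 1))
  have hn : (0 : ℝ) < n + 1 := by positivity
  have hrpos : 0 < r := lt_min (lt_min hr₁ hr₂) (by positivity)
  have hnr : n * r < 1 := by
    have : r ≤ 1 / (n + 1) := min_le_right _ _
    rw [le_div_iff₀ hn] at this
    linarith
  refine x₀.2.2 ⟨Metric.ball x₀ (r / 2), ⟨Metric.isOpen_ball,
    isSmoothlyApproximable_ball_of_subset_pointwiseLipschitzSet hg hΩ hΩb hu hB hBΩ hloc x₀.2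
      (M := M) hrpos hnr (fun y hy => ?_) fun y hy => ?_⟩, Metric.mem_ball_self (by positivity)⟩
  · exact hsub (show (⟨y, hy.1⟩ : B) ∈ Metric.ball x₀ r₁ from
      Metric.ball_subset_ball (x := (x₀ : E)) ((min_le_left _ _).trans (min_le_left _ _)) hy.2)
  · exact hM y ⟨Metric.ball_subset_ball ((min_le_left _ _).trans (min_le_right _ _)) hy.1, hy.2⟩

/-- Smooth approximation by functions vanishing near a set of zero capacity: the cutoffs `φ` are
large on `A` and have small modular. -/
theorem ContDiffOn.exists_contDiff_vanishing_approx [IsFiniteMeasureOnCompacts μ]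
    (hg : IsDoublingGauge g) (hΩ : IsOpen Ω) (hΩb : Bornology.IsBounded Ω)
    (hu : ContDiffOn ℝ (⊤ : ℕ∞) u (closure Ω)) {A : Set E}
    (hA : ∀ ρ : ℝ≥0∞, ρ ≠ 0 → ∃ φ : E → ℝ, ContDiff ℝ (⊤ : ℕ∞) φ ∧ (∀ x ∈ A, 1 ≤ φ x) ∧
      ∫⁻ x, g (jetNorm φ x) ∂μ ≤ ρ) {ε : ℝ≥0∞} (hε : ε ≠ 0) :
    ∃ f : E → ℝ, ContDiff ℝ (⊤ : ℕ∞) f ∧ (∃ V, IsOpen V ∧ A ⊆ V ∧ ∀ x ∈ V, f x = 0) ∧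
      ∫⁻ x in Ω, g (jetNorm (fun y => u y - f y) x) ∂μ ≤ ε := by
  obtain ⟨C, hC, hadd⟩ := hg.exists_lintegral_add_le μ
  obtain ⟨ρ, hρ, hρε⟩ := ENNReal.exists_mul_le (C := C * 2)
    (ENNReal.mul_ne_top hC ENNReal.ofNat_ne_top) hε
  obtain ⟨f, hf, hfρ⟩ := hu.isSmoothlyApproximable_closure (μ := μ) hg hΩ hΩb ρ hρ
  rw [inter_self] at hfρ
  obtain ⟨θ, L, hθ, hθL, hθ0, hθ1⟩ := exists_contDiff_step
  obtain ⟨D, hD, hmul⟩ := hg.exists_lintegral_mul_le μ hf hΩb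
  obtain ⟨D', hD', hscale⟩ := hg.scale L
  obtain ⟨ρ', hρ', hρρ⟩ := ENNReal.exists_mul_le (ENNReal.mul_ne_top hD hD') hρ
  obtain ⟨φ, hφ, hφA, hφρ⟩ := hA ρ' hρ'
  have hψ : ContDiff ℝ (⊤ : ℕ∞) (fun y => θ (φ y)) := hθ.comp hφ
  have hj : ∀ x, jetNorm (fun y => θ (φ y)) x ≤ L * jetNorm φ x := by
    intro x
    have h1 : |θ (φ x)| ≤ L * |φ x| := by
      simpa [hθ0, Real.dist_eq] using hθL.dist_le_mul (φ x) 0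
    have h2 : ‖fderiv ℝ (fun y => θ (φ y)) x‖ ≤ L * ‖fderiv ℝ φ x‖ := by
      have hc : fderiv ℝ (fun y => θ (φ y)) x = (fderiv ℝ θ (φ x)).comp (fderiv ℝ φ x) :=
        fderiv_comp x (hθ.differentiable (by simp) _) (hφ.differentiable (by simp) x)
      rw [hc]
      exact (ContinuousLinearMap.opNorm_comp_le _ _).trans
        (mul_le_mul_of_nonneg_right (norm_fderiv_le_of_lipschitz ℝ hθL) (norm_nonneg _))
    rw [jetNorm, jetNorm, mul_add]
    exact add_le_add h1 h2
  refine ⟨fun y => (1 - θ (φ y)) * f y, (contDiff_const.sub hψ).mul hf,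
    ⟨{x | 1 / 2 < φ x}, isOpen_lt continuous_const hφ.continuous, fun x hx => ?_, fun x hx => ?_⟩,
    ?_⟩
  · exact lt_of_lt_of_le (by norm_num) (hφA x hx)
  · have h1 : θ (φ x) = 1 := hθ1 _ hx
    simp [h1]
  have heq : (fun y => u y - (1 - θ (φ y)) * f y) =
      fun y => (u y - f y) + f y * θ (φ y) := by
    funext y; ring
  have hud : ∀ x ∈ Ω, DifferentiableAt ℝ u x := fun x hx =>
    (hu.mono subset_closure).differentiableAt_of_isOpen hΩ hx
  have hfd : Differentiable ℝ f := hf.differentiable (by simp)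
  have hψd : Differentiable ℝ fun y => θ (φ y) := hψ.differentiable (by simp)
  rw [heq]
  refine (hadd (fun y => u y - f y) (fun y => f y * θ (φ y)) Ω hΩ.measurableSet
    (fun x hx => (hud x hx).sub (hfd x)) fun x _ => (hfd x).mul (hψd x)).trans ?_
  refine le_trans ?_ hρε
  rw [mul_assoc, two_mul]
  gcongr
  refine (hmul (fun y => θ (φ y)) Ω univ le_rfl hΩ.measurableSet MeasurableSet.univ
    (fun x _ => hψd x) (by simp)).trans ?_
  refine le_trans ?_ hρρ
  rw [mul_assoc]
  gcongr
  calc ∫⁻ x in univ ∩ Ω, g (jetNorm (fun y => θ (φ y)) x) ∂μ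
      ≤ ∫⁻ x, g (jetNorm (fun y => θ (φ y)) x) ∂μ := setLIntegral_le_lintegral _ _
    _ ≤ ∫⁻ x, D' * g (jetNorm φ x) ∂μ :=
        lintegral_mono fun x => (hg.mono (hj x)).trans (hscale _ jetNorm_nonneg)
    _ = D' * ∫⁻ x, g (jetNorm φ x) ∂μ := lintegral_const_mul' _ _ hD'
    _ ≤ D' * ρ' := by gcongr

end Approximable

section Young

variable {G : ℝ → ℝ}

/-- A Young function, extended by zero to the negative half-line, as an `ℝ≥0∞`-valued gauge. -/
def youngGauge (G : ℝ → ℝ) (t : ℝ) : ℝ≥0∞ := ENNReal.ofReal (G (max t 0))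

theorem youngGauge_of_nonneg {t : ℝ} (ht : 0 ≤ t) : youngGauge G t = ENNReal.ofReal (G t) := by
  rw [youngGauge, max_eq_left ht]

theorem isDoublingGauge_youngGauge {p : ℝ} (hG0 : G 0 = 0) (hG : MonotoneOn G (Ici 0))
    (hup : ∀ l : ℝ, 1 ≤ l → ∀ t ≥ (0 : ℝ), G (l * t) ≤ l ^ p * G t) :
    IsDoublingGauge (youngGauge G) where
  mono s t hst := ENNReal.ofReal_le_ofReal
    (hG (mem_Ici.2 (le_max_right _ _)) (mem_Ici.2 (le_max_right _ _)) (max_le_max_right 0 hst))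
  zero := by simp [youngGauge, hG0]
  ne_top t := ENNReal.ofReal_ne_top
  scale K := by
    refine ⟨ENNReal.ofReal (max 1 K ^ p), ENNReal.ofReal_ne_top, fun t ht => ?_⟩
    rw [youngGauge_of_nonneg ht, youngGauge, ← ENNReal.ofReal_mul (by positivity)]
    refine ENNReal.ofReal_le_ofReal (le_trans (hG (mem_Ici.2 (le_max_right _ _)) (mem_Ici.2 ?_) ?_)
      (hup (max 1 K) (le_max_left _ _) t ht))
    · exact mul_nonneg (by positivity) ht
    · exact max_le (mul_le_mul_of_nonneg_right (le_max_right _ _) ht)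
        (mul_nonneg (by positivity) ht)

theorem luxemburgNorm_le {E : Type*} [MeasurableSpace E] {μ : Measure E} {v : E → ℝ} {l : ℝ}
    (hl : 0 < l) (h : ∫⁻ x, ENNReal.ofReal (G (|v x| / l)) ∂μ ≤ 1)
    (hG : ∀ t, 0 ≤ t → 0 ≤ G t) : luxemburgNorm μ G v ≤ l := by
  refine csInf_le ⟨0, fun a ha => ha.1.le⟩ ⟨hl, ?_⟩
  by_cases hi : Integrable (fun x => G (|v x| / l)) μ
  · rw [integral_eq_lintegral_of_nonneg_ae
      (Eventually.of_forall fun x => hG _ (by positivity)) hi.aestronglyMeasurable]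
    exact ENNReal.toReal_le_of_le_ofReal zero_le_one (by simpa using h)
  · rw [integral_undef hi]
    exact zero_le_one

theorem exists_WnormG_le {Ω : Set (EuclideanSpace ℝ (Fin N))} (hg : IsDoublingGauge (youngGauge G))
    (hG : ∀ t, 0 ≤ t → 0 ≤ G t) {ε : ℝ} (hε : 0 < ε) :
    ∃ ρ : ℝ≥0∞, ρ ≠ 0 ∧ ∀ w : EuclideanSpace ℝ (Fin N) → ℝ,
      ∫⁻ x in Ω, youngGauge G (jetNorm w x) ≤ ρ → WnormG Ω G w ≤ ε := by
  obtain ⟨C, hC, hscale⟩ := hg.scale (ε / 2)⁻¹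
  obtain ⟨ρ, hρ, hρ1⟩ := ENNReal.exists_mul_le hC one_ne_zero
  refine ⟨ρ, hρ, fun w hw => ?_⟩
  have key : ∀ v : EuclideanSpace ℝ (Fin N) → ℝ, (∀ x, |v x| ≤ jetNorm w x) →
      luxemburgNorm (volume.restrict Ω) G v ≤ ε / 2 := by
    intro v hv
    refine luxemburgNorm_le (half_pos hε) (le_trans ?_ hρ1) hG
    calc ∫⁻ x in Ω, ENNReal.ofReal (G (|v x| / (ε / 2)))
        ≤ ∫⁻ x in Ω, C * youngGauge G (jetNorm w x) := by
          refine lintegral_mono fun x => ?_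
          rw [← youngGauge_of_nonneg (by positivity), div_eq_inv_mul]
          exact (hscale _ (abs_nonneg _)).trans (by gcongr; exact hg.mono (hv x))
      _ = C * ∫⁻ x in Ω, youngGauge G (jetNorm w x) := lintegral_const_mul' _ _ hC
      _ ≤ C * ρ := by gcongr
  have h1 := key w fun x => le_add_of_nonneg_right (norm_nonneg _)
  have h2 := key (fun x => ‖fderiv ℝ w x‖) fun x => by
    rw [abs_of_nonneg (norm_nonneg _)]
    exact le_add_of_nonneg_left (abs_nonneg _)
  rw [WnormG]
  linarith

theorem exists_lintegral_le_of_capG_eq_zero {A : Set (EuclideanSpace ℝ (Fin N))}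
    (hg : IsDoublingGauge (youngGauge G)) (hG : ∀ t, 0 ≤ t → 0 ≤ G t)
    (hclassne : {c : ℝ | ∃ φ : EuclideanSpace ℝ (Fin N) → ℝ, ContDiff ℝ (⊤ : ℕ∞) φ ∧
      Integrable (fun x => G |φ x| + G ‖fderiv ℝ φ x‖) volume ∧
      (∀ x ∈ A, 1 ≤ φ x) ∧ c = ∫ x, (G |φ x| + G ‖fderiv ℝ φ x‖)}.Nonempty)
    (hcap : capG G A = 0) {ρ : ℝ≥0∞} (hρ : ρ ≠ 0) :
    ∃ φ : EuclideanSpace ℝ (Fin N) → ℝ, ContDiff ℝ (⊤ : ℕ∞) φ ∧ (∀ x ∈ A, 1 ≤ φ x) ∧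
      ∫⁻ x, youngGauge G (jetNorm φ x) ≤ ρ := by
  obtain ⟨C, hC, hadd⟩ := hg.exists_add_le
  obtain ⟨σ, hσ, hσρ⟩ := ENNReal.exists_mul_le hC hρ
  obtain ⟨e, he, heσ⟩ := ENNReal.lt_iff_exists_nnreal_btwn.1 (pos_iff_ne_zero.2 hσ)
  obtain ⟨c, ⟨φ, hφ, hint, hφA, rfl⟩, hc⟩ :=
    exists_lt_of_csInf_lt hclassne (show capG G A < e by rw [hcap]; exact_mod_cast he)
  refine ⟨φ, hφ, hφA, le_trans ?_ hσρ⟩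
  calc ∫⁻ x, youngGauge G (jetNorm φ x)
      ≤ ∫⁻ x, C * ENNReal.ofReal (G |φ x| + G ‖fderiv ℝ φ x‖) := by
        refine lintegral_mono fun x => (hadd _ _ (abs_nonneg _) (norm_nonneg _)).trans_eq ?_
        rw [youngGauge_of_nonneg (abs_nonneg _), youngGauge_of_nonneg (norm_nonneg _),
          ENNReal.ofReal_add (hG _ (abs_nonneg _)) (hG _ (norm_nonneg _))]
    _ = C * ENNReal.ofReal (∫ x, (G |φ x| + G ‖fderiv ℝ φ x‖)) := by
        rw [lintegral_const_mul' _ _ hC, ofReal_integral_eq_lintegral_ofReal hint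
          (Eventually.of_forall fun x => add_nonneg (hG _ (abs_nonneg _)) (hG _ (norm_nonneg _)))]
    _ ≤ C * σ := by
        gcongr
        refine (ENNReal.ofReal_le_ofReal hc.le).trans ?_
        rw [ENNReal.ofReal_coe_nnreal]
        exact heσ.le

end Young

/-- if `Cap_G(A) = 0` (with the capacity infimum over a nonempty class),
then every `u ∈ C^∞(clos Ω)` can be approximated in the `W^{1,G}(Ω)` norm by smooth
functions vanishing on a neighborhood of `A`; consequently
`W^{1,G}_A(Ω) = W^{1,G}(Ω)`. -/
theorem stmt17 (hN : 2 ≤ N) (G : ℝ → ℝ) (gm gp : ℝ)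
    (Ω A : Set (EuclideanSpace ℝ (Fin N)))
    (hΩopen : IsOpen Ω) (hΩbd : Bornology.IsBounded Ω) (hΩne : Ω.Nonempty)
    (hA : A ⊆ Ω)
    (hG0 : G 0 = 0) (hGsm : StrictMonoOn G (Set.Ici 0))
    (hGconv : ConvexOn ℝ (Set.Ici 0) G) (hGtop : Tendsto G atTop atTop)
    (hGD2 : ∃ C > 0, ∀ t ≥ (0:ℝ), G (2 * t) ≤ C * G t)
    (hgm : 1 < gm) (hgmgp : gm ≤ gp)
    (hup : ∀ l : ℝ, 1 ≤ l → ∀ t ≥ (0:ℝ), G (l * t) ≤ l ^ gp * G t)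
    (hlow : ∀ l : ℝ, 0 < l → l ≤ 1 → ∀ t ≥ (0:ℝ), G (l * t) ≤ l ^ gm * G t)
    -- the capacity class is nonempty and the capacity of A vanishes
    (hclassne : {c : ℝ | ∃ φ : EuclideanSpace ℝ (Fin N) → ℝ, ContDiff ℝ (⊤ : ℕ∞) φ ∧
      Integrable (fun x => G |φ x| + G ‖fderiv ℝ φ x‖) volume ∧
      (∀ x ∈ A, 1 ≤ φ x) ∧ c = ∫ x, (G |φ x| + G ‖fderiv ℝ φ x‖)}.Nonempty)
    (hcap : capG G A = 0) :
    ∀ u : EuclideanSpace ℝ (Fin N) → ℝ, ContDiffOn ℝ (⊤ : ℕ∞) u (closure Ω) →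
      ∀ ε > 0, ∃ uε : EuclideanSpace ℝ (Fin N) → ℝ,
        ContDiff ℝ (⊤ : ℕ∞) uε ∧
        (∃ V, IsOpen V ∧ A ⊆ V ∧ ∀ x ∈ V, uε x = 0) ∧
        WnormG Ω G (fun x => u x - uε x) ≤ ε := by
  intro u hu ε hε
  have hGnn : ∀ t, 0 ≤ t → 0 ≤ G t := fun t ht =>
    hG0.symm.le.trans (hGsm.monotoneOn Set.self_mem_Ici ht ht)
  have hg := isDoublingGauge_youngGauge hG0 hGsm.monotoneOn hup
  obtain ⟨ρ, hρ, hnorm⟩ := exists_WnormG_le (Ω := Ω) hg hGnn hε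
  obtain ⟨f, hf, hV, hle⟩ := hu.exists_contDiff_vanishing_approx hg hΩopen hΩbd
    (fun σ hσ => exists_lintegral_le_of_capG_eq_zero hg hGnn hclassne hcap hσ) hρ
  exact ⟨f, hf, hV, hnorm _ hle⟩

end
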